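/- The random variables |A_n| converge to |A| in L²; that is, E[(|A_n| − |A|)²] → 0 as n → ∞. -/

import Mathlib

open MeasureTheory ProbabilityTheory Filter Topology
open scoped RealInnerProductSpace

noncomputable section

/-- Euclidean space `ℝ^d`. -/
abbrev EucSp (d : ℕ) := EuclideanSpace ℝ (Fin d)

/-- The closed Voronoi cell of `x` relative to the point set `S`:
all points at least as close to `x` as to any point of `S`. -/
def vorCell {d : ℕ} (x : EucSp d) (S : Set (EucSp d)) : Set (EucSp d) :=
  {y | ∀ z ∈ S, dist y x ≤ dist y z}

/-- The open unit cube `(0,1)^d`. -/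
def unitCube (d : ℕ) : Set (EucSp d) := {x | ∀ i, x i ∈ Set.Ioo (0 : ℝ) 1}

/-- The sample set `𝒳_n = {X_0, …, X_{n-1}}` at outcome `ω`. -/
def sample {d : ℕ} {Ωp : Type*} (X : ℕ → Ωp → EucSp d) (n : ℕ) (ω : Ωp) :
    Set (EucSp d) :=
  (fun i => X i ω) '' Set.Iio n

/-- The Voronoi estimator `A_n = ⋃_{x ∈ 𝒳_n ∩ A} (Ṽ(x;𝒳_n) ∩ Ω)`. -/
def vorEst {d : ℕ} {Ωp : Type*} (X : ℕ → Ωp → EucSp d) (A : Set (EucSp d))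
    (n : ℕ) (ω : Ωp) : Set (EucSp d) :=
  ⋃ i ∈ Set.Iio n, ⋃ (_ : X i ω ∈ A), vorCell (X i ω) (sample X n ω) ∩ unitCube d

lemma cont_real_closedBall {d : ℕ} (μ : Measure (EucSp d)) [IsFiniteMeasure μ] (y : EucSp d)
    (hs : ∀ r, μ (Metric.sphere y r) = 0) :
    Continuous fun r => μ.real (Metric.closedBall y r) := by
  have heq : (fun r => μ.real (Metric.closedBall y r))
      = fun r => ∫ x, (Metric.closedBall y r).indicator (fun _ => (1 : ℝ)) x ∂μ := by
    funext r
    rw [integral_indicator_const _ Metric.isClosed_closedBall.measurableSet]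
    simp
  rw [heq, continuous_iff_continuousAt]
  intro r
  refine tendsto_integral_filter_of_dominated_convergence (fun _ => (1 : ℝ)) ?_ ?_ ?_ ?_
  · refine Eventually.of_forall fun r => ?_
    exact (measurable_const.indicator Metric.isClosed_closedBall.measurableSet).aestronglyMeasurable
  · refine Eventually.of_forall fun r => Eventually.of_forall fun x => ?_
    by_cases h : x ∈ Metric.closedBall y r <;> simp [Set.indicator, h]
  · exact integrable_const _
  · have : ∀ᵐ x ∂μ, x ∉ Metric.sphere y r := measure_eq_zero_iff_ae_notMem.1 (hs r)
    filter_upwards [this] with x hx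
    have hx' : dist x y ≠ r := hx
    rcases lt_or_gt_of_ne hx' with h | h
    · refine tendsto_const_nhds.congr' ?_
      filter_upwards [lt_mem_nhds h] with r' hr'
      simp [Set.indicator, h.le, hr'.le]
    · refine tendsto_const_nhds.congr' ?_
      filter_upwards [gt_mem_nhds h] with r' hr'
      simp [Set.indicator, not_le.2 h, not_le.2 hr']

/-- The event that some nearest sample point to `y` is not in `S`. -/
def badEv {d : ℕ} {Ωp : Type*} (X : ℕ → Ωp → EucSp d) (S : Set (EucSp d))
    (n : ℕ) (y : EucSp d) : Set Ωp :=
  {ω | ∃ i < n, X i ω ∉ S ∧ ∀ j < n, dist y (X i ω) ≤ dist y (X j ω)}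

lemma bad_bound {d : ℕ} {Ωp : Type*} [MeasurableSpace Ωp] (P : Measure Ωp)
    [IsProbabilityMeasure P] (μ : Measure (EucSp d)) [IsProbabilityMeasure μ]
    (X : ℕ → Ωp → EucSp d) (hXmeas : ∀ i, Measurable (X i))
    (hiid : iIndepFun X P) (hlaw : ∀ i, Measure.map (X i) P = μ)
    (S : Set (EucSp d)) (hS : MeasurableSet S) (y : EucSp d) (r : ℝ) (n : ℕ) :
    P.real (badEv X S n y) ≤ (1 - μ.real (Metric.closedBall y r)) ^ n
      + n * μ.real (Metric.closedBall y r \ S) := by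
  set B := Metric.closedBall y r with hB
  have hBm : MeasurableSet B := Metric.isClosed_closedBall.measurableSet
  have hl : ∀ i, ∀ T, MeasurableSet T → P.real (X i ⁻¹' T) = μ.real T := by
    intro i T hT
    rw [← hlaw i, map_measureReal_apply (hXmeas i) hT]
  have hsub : badEv X S n y ⊆ (⋂ i ∈ Finset.range n, X i ⁻¹' Bᶜ) ∪
      ⋃ i ∈ Finset.range n, X i ⁻¹' (B \ S) := by
    rintro ω ⟨i, hi, hiS, hmin⟩
    by_cases hall : ∀ j < n, X j ω ∉ B
    · left
      simpa using hall
    · right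
      push Not at hall
      obtain ⟨j, hj, hjB⟩ := hall
      simp only [Set.mem_iUnion]
      refine ⟨i, Finset.mem_range.2 hi, ?_, hiS⟩
      have := hmin j hj
      rw [hB, Metric.mem_closedBall'] at hjB ⊢
      exact this.trans hjB
  refine (measureReal_mono hsub).trans ((measureReal_union_le _ _).trans (add_le_add ?_ ?_))
  · have := hiid.measure_inter_preimage_eq_mul (Finset.range n) (sets := fun _ => Bᶜ)
      (fun _ _ => hBm.compl)
    rw [measureReal_def, this, ENNReal.toReal_prod]
    simp only [← measureReal_def]
    rw [Finset.prod_congr rfl (fun i _ => hl i _ hBm.compl)]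
    simp [probReal_compl_eq_one_sub hBm]
  · refine (measureReal_biUnion_finset_le _ _).trans ?_
    rw [Finset.sum_congr rfl (fun i _ => hl i _ (hBm.diff hS))]
    simp

lemma bad_tendsto {d : ℕ} {Ωp : Type*} [MeasurableSpace Ωp] (P : Measure Ωp)
    [IsProbabilityMeasure P] (μ : Measure (EucSp d)) [IsProbabilityMeasure μ]
    (X : ℕ → Ωp → EucSp d) (hXmeas : ∀ i, Measurable (X i))
    (hiid : iIndepFun X P) (hlaw : ∀ i, Measure.map (X i) P = μ)
    (S : Set (EucSp d)) (hS : MeasurableSet S) (y : EucSp d)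
    (hs : ∀ r, μ (Metric.sphere y r) = 0)
    (hy : Tendsto (fun r => μ (S ∩ Metric.closedBall y r) / μ (Metric.closedBall y r))
      (𝓝[>] 0) (𝓝 1)) :
    Tendsto (fun n => P.real (badEv X S n y)) atTop (𝓝 0) := by
  rw [Metric.tendsto_atTop]
  intro ε hε
  obtain ⟨K, hK0, hK⟩ : ∃ K : ℝ, 0 < K ∧ Real.exp (-K) < ε / 2 := by
    have h1 : Tendsto (fun K : ℝ => Real.exp (-K)) atTop (𝓝 0) := Real.tendsto_exp_neg_atTop_nhds_zero
    obtain ⟨K, h1, h2⟩ := ((eventually_gt_atTop (0 : ℝ)).and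
      (h1.eventually (gt_mem_nhds (by positivity : (0 : ℝ) < ε / 2)))).exists
    exact ⟨K, h1, h2⟩
  set η : ℝ := ε / (2 * K) with hη
  have hη0 : 0 < η := by positivity
  have hy' : Tendsto (fun r => μ.real (S ∩ Metric.closedBall y r) / μ.real (Metric.closedBall y r))
      (𝓝[>] 0) (𝓝 1) := by
    have := (ENNReal.tendsto_toReal (by simp : (1 : ENNReal) ≠ ⊤)).comp hy
    simpa [Function.comp_def, ENNReal.toReal_div, measureReal_def] using this
  have hev : ∀ᶠ r in 𝓝[>] (0 : ℝ), 0 < μ.real (Metric.closedBall y r) ∧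
      μ.real (Metric.closedBall y r \ S) ≤ η * μ.real (Metric.closedBall y r) := by
    filter_upwards [hy'.eventually (lt_mem_nhds (by norm_num : (0 : ℝ) < 1)),
      hy'.eventually (lt_mem_nhds (by linarith : 1 - η < 1))] with r h0 h1
    have hpos : 0 < μ.real (Metric.closedBall y r) := by
      refine lt_of_le_of_ne measureReal_nonneg fun h => ?_
      rw [← h] at h0
      simp at h0
    refine ⟨hpos, ?_⟩
    rw [lt_div_iff₀ hpos] at h1
    have := measureReal_inter_add_sdiff (μ := μ) (s := Metric.closedBall y r) hS
    rw [Set.inter_comm] at this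
    linarith
  obtain ⟨δ, hδ0, hδ⟩ := mem_nhdsGT_iff_exists_Ioc_subset.1 hev
  have hδ0 : (0 : ℝ) < δ := hδ0
  have hm := (hδ ⟨hδ0, le_rfl⟩).1
  obtain ⟨N, hN⟩ := exists_nat_gt (K / μ.real (Metric.closedBall y δ))
  refine ⟨max N (⌈K⌉₊ + 1), fun n hn => ?_⟩
  have hnN : (N : ℝ) ≤ n := by exact_mod_cast (le_max_left _ _).trans hn
  have hnK : K ≤ n := (Nat.le_ceil K).trans (by
    exact_mod_cast (Nat.le_succ _).trans ((le_max_right _ _).trans hn))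
  have hn0 : (0 : ℝ) < n := hK0.trans_le hnK
  have hle : K / n ≤ μ.real (Metric.closedBall y δ) := by
    rw [div_le_iff₀ hn0]
    have := hN.trans_le hnN
    rw [div_lt_iff₀ hm] at this
    linarith
  have h00 : μ.real (Metric.closedBall y 0) = 0 := by
    have := hs 0
    rw [Metric.sphere_zero] at this
    simp [measureReal_def, this]
  obtain ⟨r, hr, hrK⟩ := intermediate_value_Icc hδ0.le
    (cont_real_closedBall μ y hs).continuousOn
    (show K / n ∈ Set.Icc _ _ from ⟨by rw [h00]; positivity, hle⟩)
  simp only at hrK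
  have hr0 : 0 < r := by
    rcases hr.1.eq_or_lt with h | h
    · rw [← h, h00] at hrK
      have : 0 < K / n := by positivity
      linarith
    · exact h
  have hb := bad_bound P μ X hXmeas hiid hlaw S hS y r n
  have h2 := (hδ ⟨hr0, hr.2⟩).2
  rw [hrK] at hb h2
  have h3 := Real.one_sub_div_pow_le_exp_neg hnK
  have h4 : n * μ.real (Metric.closedBall y r \ S) ≤ ε / 2 := by
    calc n * μ.real (Metric.closedBall y r \ S) ≤ n * (η * (K / n)) := by gcongr
      _ = ε / 2 := by rw [hη]; field_simp
  rw [Real.dist_eq, sub_zero, abs_of_nonneg measureReal_nonneg]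
  linarith

open Classical in
lemma symm_bad {d : ℕ} {Ωp : Type*} (X : ℕ → Ωp → EucSp d) (A : Set (EucSp d))
    (n : ℕ) (hn : 0 < n) (y : EucSp d) (hy : y ∈ unitCube d) :
    {ω | y ∈ symmDiff (vorEst X A n ω) A} ⊆
      badEv X (if y ∈ A then A else Aᶜ) n y := by
  intro ω hω
  have hmem : ∀ i < n, X i ω ∈ A → (∀ j < n, dist y (X i ω) ≤ dist y (X j ω)) →
      y ∈ vorEst X A n ω := by
    intro i hi hiA h
    simp only [vorEst, Set.mem_iUnion]
    refine ⟨i, hi, hiA, ?_, hy⟩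
    rintro z ⟨j, hj, rfl⟩
    exact h j hj
  rcases hω with ⟨h1, h2⟩ | ⟨h1, h2⟩
  · rw [if_neg h2]
    simp only [vorEst, Set.mem_iUnion] at h1
    obtain ⟨i, hi, hiA, hc, -⟩ := h1
    exact ⟨i, hi, fun h => h hiA, fun j hj => hc _ ⟨j, hj, rfl⟩⟩
  · rw [if_pos h1]
    obtain ⟨i, hi, hmin⟩ := (Finset.range n).exists_min_image (fun i => dist y (X i ω))
      ⟨0, Finset.mem_range.2 hn⟩
    have hi' := Finset.mem_range.1 hi
    have hmin' : ∀ j < n, dist y (X i ω) ≤ dist y (X j ω) :=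
      fun j hj => hmin j (Finset.mem_range.2 hj)
    exact ⟨i, hi', fun h => h2 (hmem i hi' h hmin'), hmin'⟩

lemma meas_cube (d : ℕ) : MeasurableSet (unitCube d) := by
  have : unitCube d = ⋂ i, {x : EucSp d | x i ∈ Set.Ioo (0 : ℝ) 1} := by
    ext x; simp [unitCube]
  rw [this]
  refine MeasurableSet.iInter fun i => ?_
  have : Measurable fun x : EucSp d => x i := by fun_prop
  exact this measurableSet_Ioo

lemma meas_est {d : ℕ} {Ωp : Type*} [MeasurableSpace Ωp]
    (X : ℕ → Ωp → EucSp d) (hXmeas : ∀ i, Measurable (X i))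
    (A : Set (EucSp d)) (hA : MeasurableSet A) (n : ℕ) :
    MeasurableSet {p : Ωp × EucSp d | p.2 ∈ vorEst X A n p.1} := by
  have : {p : Ωp × EucSp d | p.2 ∈ vorEst X A n p.1} = ⋃ i ∈ Set.Iio n,
      ({p : Ωp × EucSp d | X i p.1 ∈ A} ∩
        (⋂ j ∈ Set.Iio n, {p : Ωp × EucSp d | dist p.2 (X i p.1) ≤ dist p.2 (X j p.1)})) ∩
        {p : Ωp × EucSp d | p.2 ∈ unitCube d} := by
    ext p
    simp [vorEst, vorCell, sample]
    grind
  rw [this]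
  refine MeasurableSet.biUnion (Set.to_countable _) fun i _ => ?_
  refine MeasurableSet.inter (MeasurableSet.inter ?_ ?_) (measurable_snd (meas_cube d))
  · exact ((hXmeas i).comp measurable_fst) hA
  · refine MeasurableSet.biInter (Set.to_countable _) fun j _ => ?_
    have hi : Measurable fun p : Ωp × EucSp d => X i p.1 := (hXmeas i).comp measurable_fst
    have hj : Measurable fun p : Ωp × EucSp d => X j p.1 := (hXmeas j).comp measurable_fst
    exact measurableSet_le (measurable_snd.dist hi) (measurable_snd.dist hj)

/-- `|A_n| → |A|` in `L²`: `E[(|A_n| − |A|)²] → 0` as `n → ∞`. -/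
theorem stmt2 {d : ℕ} (hd : 1 ≤ d)
    {Ωp : Type*} [MeasureSpace Ωp] [IsProbabilityMeasure (ℙ : Measure Ωp)]
    (κ : EucSp d → ℝ) (hκmeas : Measurable κ)
    (hκ0 : ∀ x ∉ unitCube d, κ x = 0)
    (hκpos : ∃ c > 0, ∀ x ∈ unitCube d, c ≤ κ x)
    (X : ℕ → Ωp → EucSp d) (hXmeas : ∀ i, Measurable (X i))
    (hiid : iIndepFun X ℙ)
    (hlaw : ∀ i, Measure.map (X i) ℙ
      = volume.withDensity fun x => ENNReal.ofReal (κ x))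
    (A : Set (EucSp d)) (hA : MeasurableSet A) (hAΩ : A ⊆ unitCube d) :
    Tendsto
      (fun n => ∫ ω, ((volume (vorEst X A n ω)).toReal - (volume A).toReal) ^ 2 ∂ℙ)
      atTop (𝓝 0) := by
  classical
  obtain ⟨c, hc0, hc⟩ := hκpos
  set μ : Measure (EucSp d) := volume.withDensity fun x => ENNReal.ofReal (κ x) with hμ
  have : IsProbabilityMeasure μ := by
    rw [← hlaw 0]
    exact Measure.isProbabilityMeasure_map (hXmeas 0).aemeasurable
  have : Nonempty (Fin d) := ⟨⟨0, hd⟩⟩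
  have hcm := meas_cube d
  -- comparison of volume with μ on the cube
  have hcomp : ∀ T, ENNReal.ofReal c * volume (T ∩ unitCube d) ≤ μ T := by
    intro T
    calc ENNReal.ofReal c * volume (T ∩ unitCube d)
        = ∫⁻ x in T ∩ unitCube d, ENNReal.ofReal c := by rw [setLIntegral_const]
      _ ≤ ∫⁻ x in T ∩ unitCube d, ENNReal.ofReal (κ x) := by
          refine lintegral_mono_ae ?_
          have : ∀ᵐ x ∂(volume.restrict (unitCube d)), x ∈ unitCube d := ae_restrict_mem hcm
          have := ae_restrict_of_ae_restrict_of_subset (s := T ∩ unitCube d)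
            Set.inter_subset_right this
          filter_upwards [this] with x hx
          exact ENNReal.ofReal_le_ofReal (hc x hx)
      _ ≤ ∫⁻ x in T, ENNReal.ofReal (κ x) := lintegral_mono_set Set.inter_subset_left
      _ ≤ μ T := withDensity_apply_le _ _
  have hc' : ENNReal.ofReal c ≠ 0 := by simpa using hc0
  have hfin : volume (unitCube d) ≠ ⊤ := by
    intro h
    have := hcomp (unitCube d)
    rw [Set.inter_self, h, ENNReal.mul_top hc'] at this
    exact measure_ne_top μ _ (top_le_iff.1 this)
  set V : Measure (EucSp d) := volume.restrict (unitCube d) with hV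
  have : IsFiniteMeasure V := ⟨by simpa [hV] using hfin.lt_top⟩
  have hVμ : V ≪ μ := by
    refine Measure.AbsolutelyContinuous.mk fun T hT h0 => ?_
    have := hcomp T
    rw [h0, nonpos_iff_eq_zero, mul_eq_zero] at this
    rw [hV, Measure.restrict_apply hT]
    exact this.resolve_left hc'
  have hsph : ∀ (y : EucSp d) r, μ (Metric.sphere y r) = 0 := fun y r =>
    withDensity_absolutelyContinuous _ _ (Measure.addHaar_sphere _ y r)
  have hsec : ∀ n, MeasurableSet
      {p : Ωp × EucSp d | p.2 ∈ symmDiff (vorEst X A n p.1) A} := fun n =>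
    (meas_est X hXmeas A hA n).symmDiff (measurable_snd hA)
  -- the pointwise convergence
  have hpt : ∀ᵐ y ∂V, Tendsto (fun n => ℙ {ω | y ∈ symmDiff (vorEst X A n ω) A}) atTop (𝓝 0) := by
    filter_upwards [hVμ.ae_le (Besicovitch.ae_tendsto_measure_inter_div_of_measurableSet μ hA),
      hVμ.ae_le (Besicovitch.ae_tendsto_measure_inter_div_of_measurableSet μ hA.compl),
      ae_restrict_mem hcm] with y h1 h2 hy
    have hb : Tendsto (fun n => (ℙ : Measure Ωp).real (badEv X (if y ∈ A then A else Aᶜ) n y))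
        atTop (𝓝 0) := by
      by_cases hyA : y ∈ A
      · rw [if_pos hyA]
        refine bad_tendsto ℙ μ X hXmeas hiid hlaw A hA y (hsph y) ?_
        simpa [hyA] using h1
      · rw [if_neg hyA]
        refine bad_tendsto ℙ μ X hXmeas hiid hlaw Aᶜ hA.compl y (hsph y) ?_
        simpa [hyA] using h2
    have hb' := ENNReal.tendsto_ofReal hb
    rw [ENNReal.ofReal_zero] at hb'
    refine tendsto_of_tendsto_of_tendsto_of_le_of_le' tendsto_const_nhds hb'
      (Eventually.of_forall fun _ => zero_le) ?_
    filter_upwards [eventually_gt_atTop 0] with n hn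
    rw [ofReal_measureReal]
    exact measure_mono (symm_bad X A n hn y hy)
  have hlim : Tendsto (fun n => ∫⁻ ω, V (symmDiff (vorEst X A n ω) A) ∂ℙ) atTop (𝓝 0) := by
    have heq : ∀ n, ∫⁻ ω, V (symmDiff (vorEst X A n ω) A) ∂ℙ
        = ∫⁻ y, ℙ {ω | y ∈ symmDiff (vorEst X A n ω) A} ∂V := by
      intro n
      have h1 := Measure.prod_apply (μ := (ℙ : Measure Ωp)) (ν := V) (hsec n)
      have h2 := Measure.prod_apply_symm (μ := (ℙ : Measure Ωp)) (ν := V) (hsec n)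
      exact h1.symm.trans h2
    simp only [heq]
    have := tendsto_lintegral_of_dominated_convergence (μ := V) (fun _ => (1 : ENNReal))
      (F := fun n y => ℙ {ω | y ∈ symmDiff (vorEst X A n ω) A}) (f := fun _ => 0)
      (fun n => measurable_measure_prodMk_right (hsec n))
      (fun n => Eventually.of_forall fun y => prob_le_one) (by simp) hpt
    simpa using this
  -- bound on the integrand
  have hsubE : ∀ n ω, vorEst X A n ω ⊆ unitCube d := by
    intro n ω y hy
    simp only [vorEst, Set.mem_iUnion] at hy
    obtain ⟨i, _, _, h⟩ := hy
    exact h.2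
  have hVeq : ∀ T ⊆ unitCube d, (volume T).toReal = V.real T := by
    intro T hT
    rw [measureReal_def, hV, Measure.restrict_eq_self _ hT]
  have hpoint : ∀ n ω, ‖((volume (vorEst X A n ω)).toReal - (volume A).toReal) ^ 2‖ₑ
      ≤ V Set.univ * V (symmDiff (vorEst X A n ω) A) := by
    intro n ω
    have hmE : MeasurableSet (vorEst X A n ω) := measurable_prodMk_left (meas_est X hXmeas A hA n)
    rw [hVeq _ (hsubE n ω), hVeq _ hAΩ, ← ofReal_measureReal (μ := V) (s := Set.univ),
      ← ofReal_measureReal (μ := V) (s := symmDiff _ _),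
      ← ENNReal.ofReal_mul measureReal_nonneg, Real.enorm_eq_ofReal_abs]
    refine ENNReal.ofReal_le_ofReal ?_
    rw [abs_pow, sq]
    have hle : ∀ s t : Set (EucSp d), V.real s - V.real t ≤ V.real (symmDiff s t) := by
      intro s t
      have h1 : s ⊆ symmDiff s t ∪ t := by
        intro x hx
        by_cases h : x ∈ t
        · exact Or.inr h
        · exact Or.inl (Or.inl ⟨hx, h⟩)
      have := (measureReal_mono (μ := V) h1).trans (measureReal_union_le _ _)
      linarith
    have habs : |V.real (vorEst X A n ω) - V.real A| ≤ V.real (symmDiff (vorEst X A n ω) A) := by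
      rw [abs_le']
      refine ⟨hle _ _, ?_⟩
      rw [neg_sub, symmDiff_comm]
      exact hle _ _
    exact mul_le_mul (habs.trans (measureReal_mono (Set.subset_univ _))) habs (abs_nonneg _)
      measureReal_nonneg
  have hen : Tendsto (fun n => V Set.univ * ∫⁻ ω, V (symmDiff (vorEst X A n ω) A) ∂ℙ)
      atTop (𝓝 0) := by
    have := ENNReal.Tendsto.const_mul (a := V Set.univ) hlim (Or.inr (measure_ne_top V _))
    simpa using this
  rw [tendsto_zero_iff_enorm_tendsto_zero]
  refine tendsto_of_tendsto_of_tendsto_of_le_of_le tendsto_const_nhds hen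
    (fun _ => zero_le) fun n => ?_
  refine (enorm_integral_le_lintegral_enorm _).trans ?_
  rw [← lintegral_const_mul' _ _ (measure_ne_top V _)]
  exact lintegral_mono fun ω => hpoint n ω
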